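/- arXiv:2408.12927 — 5 statements merged into one kernel-verified Lean document; each statement's English description precedes it below -/
import Mathlib

section
/- Let F be a scoring rule with an arbitrary weight vector, R a (possibly partial) rank matrix, and c a candidate. Then c is a necessary winner of R under F if and only if for every candidate c' ≠ c, σmin_R(c) ≥ σmax_R(c'). -/
section Defs

variable {n m : ℕ} {C : Type*}

/-- A partial row (partial ballot): each candidate appears at most once. -/
def IsPartialRow (r : Fin m → Option C) : Prop :=
  ∀ ⦃k k' : Fin m⦄ ⦃c : C⦄, r k = some c → r k' = some c → k = k'

/-- `q` is a completion of the partial row `r` (a bijection from positions to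
candidates agreeing with `r` on all non-null entries). -/
def IsCompletion (r : Fin m → Option C) (q : Fin m ≃ C) : Prop :=
  ∀ ⦃k : Fin m⦄ ⦃c : C⦄, r k = some c → q k = c

/-- Number of non-null (locked) entries of a partial row. -/
def rowSize (r : Fin m → Option C) : ℕ :=
  (Finset.univ.filter fun k : Fin m => (r k).isSome).card

/-- A partial rank matrix: each candidate appears at most once in every row. -/
def IsPartialMat (R : Fin n → Fin m → Option C) : Prop :=
  ∀ i, IsPartialRow (R i)

/-- `Q` is a complete extension of the partial rank matrix `R`:
each row of `Q` is a bijection from positions to candidates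
agreeing with the corresponding row of `R` on all non-null entries. -/
def IsMatCompletion (R : Fin n → Fin m → Option C) (Q : Fin n → Fin m ≃ C) : Prop :=
  ∀ i, IsCompletion (R i) (Q i)

/-- Number of non-null (locked) entries of a partial rank matrix. -/
def matSize (R : Fin n → Fin m → Option C) : ℕ := ∑ i, rowSize (R i)

/-- `R ⊆ R'` : the partial rank matrix `R'` extends the partial rank matrix `R`. -/
def PExt (R R' : Fin n → Fin m → Option C) : Prop :=
  ∀ i k c, R i k = some c → R' i k = some c

/-- `w` is a necessary winner of the partial rank matrix `X` under voting rule `F`. -/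
def NecessaryWinner (F : (Fin n → Fin m ≃ C) → Set C)
    (X : Fin n → Fin m → Option C) (w : C) : Prop :=
  ∀ Q : Fin n → Fin m ≃ C, IsMatCompletion X Q → w ∈ F Q

/-- `R∖Y` : the partial rank matrix obtained from the complete rank matrix `R` by
erasing (making null) the entries locked in `Y`. -/
def matDiff (R : Fin n → Fin m ≃ C) (Y : Fin n → Fin m → Option C) :
    Fin n → Fin m → Option C :=
  fun i k => if (Y i k).isSome then none else some (R i k)

/-- Borda score of candidate `c` in the complete row `q` :
a candidate in position `k+1` (index `k`) scores `m - (k+1)`. -/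
def bordaRowScore (q : Fin m ≃ C) (c : C) : ℤ := (m : ℤ) - 1 - ((q.symm c : ℕ) : ℤ)

/-- Minimal Borda score of `c` over all completions of the partial row `r`. -/
noncomputable def rowSMin (r : Fin m → Option C) (c : C) : ℤ :=
  sInf {x : ℤ | ∃ q : Fin m ≃ C, IsCompletion r q ∧ bordaRowScore q c = x}

/-- Maximal Borda score of `c` over all completions of the partial row `r`. -/
noncomputable def rowSMax (r : Fin m → Option C) (c : C) : ℤ :=
  sSup {x : ℤ | ∃ q : Fin m ≃ C, IsCompletion r q ∧ bordaRowScore q c = x}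

/-- Total score margin `Δ(r) = Σ_{c' ≠ w} (σmin_r(w) − σmax_r(c'))` of `w` in the
partial row `r`, under Borda weights. -/
noncomputable def rowDelta [Fintype C] [DecidableEq C]
    (r : Fin m → Option C) (w : C) : ℤ :=
  ∑ c ∈ Finset.univ.filter (fun c : C => c ≠ w), (rowSMin r w - rowSMax r c)

/-- Borda score of candidate `c` in the complete rank matrix `Q`. -/
def bordaScore (Q : Fin n → Fin m ≃ C) (c : C) : ℤ := ∑ i, bordaRowScore (Q i) c

/-- `w ∈ Borda(Q)` : `w` has maximal Borda score in the complete rank matrix `Q`. -/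
def IsBordaWinner (Q : Fin n → Fin m ≃ C) (w : C) : Prop :=
  ∀ c, bordaScore Q c ≤ bordaScore Q w

/-- Score of candidate `c` in the complete rank matrix `Q` under the scoring rule
with weight vector `wt`. -/
def scoreW (wt : Fin m → ℝ) (Q : Fin n → Fin m ≃ C) (c : C) : ℝ :=
  ∑ i, wt ((Q i).symm c)

/-- `σmin_R(c)` : minimal score of `c` over all complete extensions of `R`. -/
noncomputable def matSMinW (wt : Fin m → ℝ) (R : Fin n → Fin m → Option C) (c : C) : ℝ :=
  sInf {x : ℝ | ∃ Q : Fin n → Fin m ≃ C, IsMatCompletion R Q ∧ scoreW wt Q c = x}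

/-- `σmax_R(c)` : maximal score of `c` over all complete extensions of `R`. -/
noncomputable def matSMaxW (wt : Fin m → ℝ) (R : Fin n → Fin m → Option C) (c : C) : ℝ :=
  sSup {x : ℝ | ∃ Q : Fin n → Fin m ≃ C, IsMatCompletion R Q ∧ scoreW wt Q c = x}

/-- `σmin_{R_i}(c)` : minimal score of `c` over all completions of the single row `r`. -/
noncomputable def rowSMinW (wt : Fin m → ℝ) (r : Fin m → Option C) (c : C) : ℝ :=
  sInf {x : ℝ | ∃ q : Fin m ≃ C, IsCompletion r q ∧ wt (q.symm c) = x}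

/-- `σmax_{R_i}(c)` : maximal score of `c` over all completions of the single row `r`. -/
noncomputable def rowSMaxW (wt : Fin m → ℝ) (r : Fin m → Option C) (c : C) : ℝ :=
  sSup {x : ℝ | ∃ q : Fin m ≃ C, IsCompletion r q ∧ wt (q.symm c) = x}

/-- `r` is in normal form of parameters `k1, k2`: a position `p = k+1` is null
exactly when `k1 < p < m + 1 - k2`. -/
def IsNormalForm (r : Fin m → Option C) (k1 k2 : ℕ) : Prop :=
  ∀ k : Fin m, r k = none ↔ (k1 < (k : ℕ) + 1 ∧ (k : ℕ) + 1 < m + 1 - k2)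

end Defs

theorem IsPartialRow.exists_isCompletion {m : ℕ} {C : Type*} [Fintype C]
    (hC : Fintype.card C = m) {r : Fin m → Option C} (hr : IsPartialRow r) :
    ∃ q : Fin m ≃ C, IsCompletion r q := by
  classical
  let e : Fin m ≃ C := (Fintype.equivFinOfCardEq hC).symm
  have hf : Set.InjOn (fun k => (r k).getD (e k))
      (Finset.univ.filter fun k => (r k).isSome : Finset (Fin m)) := by
    intro k hk k' hk' h
    simp only [Finset.coe_filter, Finset.mem_univ, true_and, Set.mem_ofPred_eq] at hk hk'
    obtain ⟨a, ha⟩ := Option.isSome_iff_exists.mp hk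
    obtain ⟨b, hb⟩ := Option.isSome_iff_exists.mp hk'
    simp only [ha, hb, Option.getD_some] at h
    exact hr ha (h ▸ hb)
  obtain ⟨g, hg⟩ := Finset.exists_equiv_extend_of_card_eq (t := Finset.univ)
    (by simp [hC]) (Finset.subset_univ _) hf
  refine ⟨g.trans (Equiv.subtypeUnivEquiv Finset.mem_univ), fun k a hk => ?_⟩
  simpa [hk] using hg k (by simp [hk])

/-- Two distinct candidates can be pushed in opposite directions in the same completion of a
row: one scores at least as much as in `q₁`, the other at most as much as in `q₂`. -/
theorem IsCompletion.exists_le_and_le {m : ℕ} {C : Type*} {r : Fin m → Option C}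
    {q₁ q₂ : Fin m ≃ C} (h₁ : IsCompletion r q₁) (h₂ : IsCompletion r q₂) (wt : Fin m → ℝ)
    {c c' : C} (hne : c' ≠ c) :
    ∃ q : Fin m ≃ C, IsCompletion r q ∧
      wt (q₁.symm c') ≤ wt (q.symm c') ∧ wt (q.symm c) ≤ wt (q₂.symm c) := by
  by_cases hp : ∃ a, r (q₁.symm c') = some a
  · obtain ⟨a, ha⟩ := hp
    have hac : c' = a := by simpa using h₁ ha
    have : q₂.symm c' = q₁.symm c' := by
      rw [Equiv.symm_apply_eq, h₂ ha, hac]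
    exact ⟨q₂, h₂, by rw [this], le_rfl⟩
  by_cases hs : ∃ a, r (q₂.symm c) = some a
  · obtain ⟨a, ha⟩ := hs
    have hac : c = a := by simpa using h₂ ha
    have : q₁.symm c = q₂.symm c := by
      rw [Equiv.symm_apply_eq, h₁ ha, hac]
    exact ⟨q₁, h₁, le_rfl, by rw [this]⟩
  by_cases hle : wt (q₁.symm c) ≤ wt (q₂.symm c)
  · exact ⟨q₁, h₁, le_rfl, hle⟩
  refine ⟨(Equiv.swap (q₂.symm c) (q₁.symm c)).trans q₁, fun k a hk => ?_, ?_, ?_⟩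
  · have hk₂ : k ≠ q₂.symm c := fun h => hs ⟨a, h ▸ hk⟩
    have hk₁ : k ≠ q₁.symm c := by
      intro h
      have hac : a = c := by rw [← h₁ hk, h, Equiv.apply_symm_apply]
      exact hk₂ ((Equiv.eq_symm_apply q₂).mpr ((h₂ hk).trans hac))
    rw [Equiv.trans_apply, Equiv.swap_apply_of_ne_of_ne hk₂ hk₁, h₁ hk]
  · rw [Equiv.symm_trans_apply, Equiv.symm_swap]
    by_cases hps : q₁.symm c' = q₂.symm c
    · rw [hps, Equiv.swap_apply_left]
      exact (not_le.mp hle).le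
    · rw [Equiv.swap_apply_of_ne_of_ne hps (fun h => hne (q₁.symm.injective h))]
  · rw [Equiv.symm_trans_apply, Equiv.symm_swap, Equiv.swap_apply_right]

theorem finite_setOf_scoreW {n m : ℕ} {C : Type*} [Finite C] (wt : Fin m → ℝ)
    (R : Fin n → Fin m → Option C) (c : C) :
    {x : ℝ | ∃ Q : Fin n → Fin m ≃ C, IsMatCompletion R Q ∧ scoreW wt Q c = x}.Finite :=
  (Set.finite_range fun Q : Fin n → Fin m ≃ C => scoreW wt Q c).subset
    fun _ ⟨Q, _, hQ⟩ => ⟨Q, hQ⟩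

/- STATEMENT 2 -/
theorem stmt2 {n m : ℕ} {C : Type*} [Fintype C] [DecidableEq C]
    (hn : 1 ≤ n) (hm : 1 ≤ m) (hC : Fintype.card C = m)
    (wt : Fin m → ℝ)
    (R : Fin n → Fin m → Option C) (hR : IsPartialMat R) (c : C) :
    -- c is a necessary winner of R under the scoring rule with weights wt:
    (∀ Q : Fin n → Fin m ≃ C, IsMatCompletion R Q → ∀ c' : C, scoreW wt Q c' ≤ scoreW wt Q c)
    ↔
    (∀ c' : C, c' ≠ c → matSMaxW wt R c' ≤ matSMinW wt R c) := by
  constructor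
  · intro h c' hne
    choose Q₀ hQ₀ using fun i => (hR i).exists_isCompletion hC
    refine csSup_le ⟨_, Q₀, hQ₀, rfl⟩ ?_
    rintro _ ⟨Q₁, hQ₁, rfl⟩
    refine le_csInf ⟨_, Q₀, hQ₀, rfl⟩ ?_
    rintro _ ⟨Q₂, hQ₂, rfl⟩
    choose Q hQ hQ₁_le hQ₂_le using fun i => (hQ₁ i).exists_le_and_le (hQ₂ i) wt hne
    calc scoreW wt Q₁ c' ≤ scoreW wt Q c' := Finset.sum_le_sum fun i _ => hQ₁_le i
      _ ≤ scoreW wt Q c := h Q hQ c'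
      _ ≤ scoreW wt Q₂ c := Finset.sum_le_sum fun i _ => hQ₂_le i
  · intro h Q hQ c'
    obtain rfl | hne := eq_or_ne c' c
    · exact le_rfl
    calc scoreW wt Q c' ≤ matSMaxW wt R c' :=
          le_csSup (finite_setOf_scoreW wt R c').bddAbove ⟨Q, hQ, rfl⟩
      _ ≤ matSMinW wt R c := h c' hne
      _ ≤ scoreW wt Q c := csInf_le (finite_setOf_scoreW wt R c).bddBelow ⟨Q, hQ, rfl⟩
end

section
/- Let R be a rank matrix with n voters and m candidates such that w is a Borda winner of R. Then every abductive explanation X of w ∈ Borda(R) satisfies |X| ≥ n − ⌊n/m⌋. -/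
theorem exists_equiv_apply_eq_apply_eq {α β : Type*} [DecidableEq α] (q : α ≃ β)
    {a b : α} {c d : β} (hab : a ≠ b) (hcd : c ≠ d) :
    ∃ q' : α ≃ β, q' a = c ∧ q' b = d := by
  let q₁ : α ≃ β := (Equiv.swap a (q.symm c)).trans q
  have h₁ : q₁ a = c := by simp [q₁]
  have ha : a ≠ q₁.symm d := fun h => hcd <| by rw [← h₁, h, Equiv.apply_symm_apply]
  exact ⟨(Equiv.swap b (q₁.symm d)).trans q₁,
    by rw [Equiv.trans_apply, Equiv.swap_apply_of_ne_of_ne hab ha, h₁], by simp⟩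

/-- If only position `k` is locked, some completion places `c` at most one position
below `w`. -/
theorem exists_equiv_symm_le_symm_add_one {m : ℕ} {C : Type*} (q : Fin m ≃ C) {w c : C}
    (k : Fin m) :
    ∃ q' : Fin m ≃ C, q' k = q k ∧ (q'.symm c : ℕ) ≤ (q'.symm w : ℕ) + 1 := by
  by_cases h : (q.symm c : ℕ) ≤ (q.symm w : ℕ) + 1
  · exact ⟨q, rfl, h⟩
  have hc := (q.symm c).isLt
  obtain ⟨x, hx⟩ : ∃ x : Fin m, (x : ℕ) = (q.symm w : ℕ) + 1 := ⟨⟨_, by omega⟩, rfl⟩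
  obtain ⟨y, hy⟩ : ∃ y : Fin m, (y : ℕ) + 1 = (q.symm c : ℕ) :=
    ⟨⟨(q.symm c : ℕ) - 1, by omega⟩, by simp only; omega⟩
  have aux (a b : Fin m) (ha : k ≠ a) (hb : k ≠ b)
      (hle : (Equiv.swap a b (q.symm c) : ℕ) ≤ (Equiv.swap a b (q.symm w) : ℕ) + 1) :
      ∃ q' : Fin m ≃ C, q' k = q k ∧ (q'.symm c : ℕ) ≤ (q'.symm w : ℕ) + 1 :=
    ⟨(Equiv.swap a b).trans q, by
      rw [Equiv.trans_apply, Equiv.swap_apply_of_ne_of_ne ha hb],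
      by simpa [Equiv.symm_trans_apply] using hle⟩
  by_cases hkw : k = q.symm w
  · refine aux (q.symm c) x (fun e => ?_) (fun e => ?_) ?_
    · rw [← e, hkw] at h; omega
    · rw [← e, hkw] at hx; omega
    · rw [Equiv.swap_apply_left, Equiv.swap_apply_of_ne_of_ne] <;>
        (try rw [ne_eq, Fin.ext_iff]) <;> omega
  · by_cases hkc : k = q.symm c
    · refine aux (q.symm w) y hkw (fun e => ?_) ?_
      · rw [← e, hkc] at hy; omega
      · rw [Equiv.swap_apply_left, Equiv.swap_apply_of_ne_of_ne] <;>
          (try rw [ne_eq, Fin.ext_iff]) <;> omega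
    · refine aux (q.symm w) (q.symm c) hkw hkc ?_
      rw [Equiv.swap_apply_left, Equiv.swap_apply_right]
      omega

/-- Every partial row has a completion in which the margin of `c` over `w` is at least
`m - 1`, less `m` for each locked entry. -/
theorem exists_isCompletion_le_bordaRowScore_sub {m : ℕ} {C : Type*} (hm : 2 ≤ m)
    {r : Fin m → Option C} {q : Fin m ≃ C} (hq : IsCompletion r q) {w c : C} (hcw : c ≠ w) :
    ∃ q' : Fin m ≃ C, IsCompletion r q' ∧
      (m : ℤ) - 1 - m * rowSize r ≤ bordaRowScore q' c - bordaRowScore q' w := by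
  unfold bordaRowScore
  rcases Nat.lt_trichotomy (rowSize r) 1 with h | h | h
  · have h0 : rowSize r = 0 := by omega
    obtain ⟨q', hc, hw⟩ := exists_equiv_apply_eq_apply_eq q
      (a := ⟨0, by omega⟩) (b := ⟨m - 1, by omega⟩) (by rw [ne_eq, Fin.ext_iff]; simp; omega) hcw
    refine ⟨q', fun k x hk => ?_, ?_⟩
    · have := Finset.filter_eq_empty_iff.1 (Finset.card_eq_zero.1 h0) (Finset.mem_univ k)
      simp [hk] at this
    · rw [h0, ← hc, ← hw]
      simp only [Equiv.symm_apply_apply]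
      push_cast
      omega
  · obtain ⟨k, hk⟩ := Finset.card_eq_one.1 h
    obtain ⟨q', hqk, hle⟩ := exists_equiv_symm_le_symm_add_one q (w := w) (c := c) k
    refine ⟨q', fun j x hj => ?_, ?_⟩
    · have hmem : j ∈ ({k} : Finset (Fin m)) := by rw [← hk]; simp [hj]
      rw [Finset.mem_singleton.1 hmem, hqk, ← Finset.mem_singleton.1 hmem, hq hj]
    · rw [h]
      push_cast
      omega
  · refine ⟨q, hq, ?_⟩
    have hc := (q.symm c).isLt
    have : (m : ℤ) * 2 ≤ m * rowSize r := by gcongr; exact_mod_cast h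
    omega

/-- A partial rank matrix guaranteeing that `w` wins has at least `(m - 1) n / m` entries. -/
theorem mul_le_mul_matSize_of_necessaryWinner {n m : ℕ} {C : Type*} (hm : 2 ≤ m)
    {R : Fin n → Fin m ≃ C} {X : Fin n → Fin m → Option C} (hR : IsMatCompletion X R) {w c : C}
    (hcw : c ≠ w)
    (hX : NecessaryWinner (fun Q => {a | IsBordaWinner Q a}) X w) :
    (n : ℤ) * (m - 1) ≤ m * matSize X := by
  choose Q hQ hle using fun i => exists_isCompletion_le_bordaRowScore_sub hm (hR i) hcw
  have hwin : bordaScore Q c ≤ bordaScore Q w := hX Q hQ c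
  have hsum := Finset.sum_le_sum fun i (_ : i ∈ Finset.univ) => hle i
  simp only [Finset.sum_sub_distrib, ← Finset.mul_sum, Finset.sum_const, Finset.card_univ,
    Fintype.card_fin, nsmul_eq_mul] at hsum
  unfold bordaScore at hwin
  unfold matSize
  push_cast
  linarith

/- STATEMENT 4 -/
theorem stmt4 {n m : ℕ} {C : Type*} [Fintype C] [DecidableEq C]
    (hn : 1 ≤ n) (hm : 2 ≤ m) (hC : Fintype.card C = m)
    (R : Fin n → Fin m ≃ C) (w : C) (hw : IsBordaWinner R w)
    (X : Fin n → Fin m → Option C)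
    -- X is an AXp of w ∈ Borda(R):
    (hX : IsPartialMat X ∧ IsMatCompletion X R ∧
      (∀ Q : Fin n → Fin m ≃ C, IsMatCompletion X Q → IsBordaWinner Q w) ∧
      (∀ X' : Fin n → Fin m → Option C, IsPartialMat X' → PExt X' X →
        (∀ Q : Fin n → Fin m ≃ C, IsMatCompletion X' Q → IsBordaWinner Q w) → PExt X X')) :
    n - n / m ≤ matSize X := by
  obtain ⟨-, hR, hwin, -⟩ := hX
  have : Nontrivial C := Fintype.one_lt_card_iff_nontrivial.1 (by omega)
  obtain ⟨c, hcw⟩ := exists_ne w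
  have key := mul_le_mul_matSize_of_necessaryWinner hm hR hcw hwin
  rw [Nat.sub_le_iff_le_add', ← Nat.sub_le_iff_le_add, Nat.le_div_iff_mul_le (by omega)]
  rcases le_total n (matSize X) with h | h
  · simp [Nat.sub_eq_zero_of_le h]
  · zify [h]
    linarith
end

section
/- Fix a candidate w and let X be the partial rank matrix with n voters and m candidates in which X_{i,1} = w for all 1 ≤ i ≤ n − ⌊n/m⌋ and all other entries are null. Then w is a necessary Borda winner of X, |X| = n − ⌊n/m⌋, and X is an abductive explanation of w ∈ Borda(R) for every complete rank matrix R with X ⊆ R (in particular w ∈ Borda(R), and the lower bound n − ⌊n/m⌋ on the size of abductive explanations for Borda is attained). -/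
theorem exists_equiv_apply_pair {α β : Type*} [DecidableEq β] (e : α ≃ β) {a b : α} {x y : β}
    (hab : a ≠ b) (hxy : x ≠ y) : ∃ f : α ≃ β, f a = x ∧ f b = y := by
  set g := e.trans (Equiv.swap (e a) x) with hg
  have ga : g a = x := by simp [hg]
  have gb : x ≠ g b := fun h => hab (g.injective (ga.trans h))
  refine ⟨g.trans (Equiv.swap (g b) y), ?_, by simp⟩
  rw [Equiv.trans_apply, ga, Equiv.swap_apply_of_ne_of_ne gb hxy]

theorem Fin.sum_ite_val_lt {n k : ℕ} (hk : k ≤ n) (a b : ℤ) :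
    ∑ i : Fin n, (if (i : ℕ) < k then a else b) = k * a + (n - k) * b := by
  obtain ⟨l, rfl⟩ := Nat.exists_eq_add_of_le hk
  simp [Fin.sum_univ_add]

theorem bordaRowScore_sub_le {m : ℕ} {C : Type*} (q : Fin m ≃ C) (c w : C) :
    bordaRowScore q c - bordaRowScore q w ≤ m - 1 := by
  have := (q.symm w).isLt
  unfold bordaRowScore
  omega

theorem bordaRowScore_sub_le_neg_one {m : ℕ} {C : Type*} {q : Fin m ≃ C} {c w : C}
    (hcw : c ≠ w) (hw : (q.symm w : ℕ) = 0) :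
    bordaRowScore q c - bordaRowScore q w ≤ -1 := by
  have : (q.symm c : ℕ) ≠ q.symm w := fun h => hcw (q.symm.injective (Fin.ext h))
  unfold bordaRowScore
  omega

/-- If `w` is ranked first by the first `n - n / m` voters, then `w` is a Borda winner. -/
theorem isBordaWinner_of_first {n m : ℕ} {C : Type*} {Q : Fin n → Fin m ≃ C} {w : C}
    (h : ∀ i : Fin n, (i : ℕ) < n - n / m → ((Q i).symm w : ℕ) = 0) : IsBordaWinner Q w := by
  intro c
  obtain rfl | hcw := eq_or_ne c w
  · exact le_rfl
  have key : ∑ i, (bordaRowScore (Q i) c - bordaRowScore (Q i) w) ≤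
      ∑ i : Fin n, (if (i : ℕ) < n - n / m then (-1 : ℤ) else m - 1) := by
    refine Finset.sum_le_sum fun i _ => ?_
    split_ifs with hi
    · exact bordaRowScore_sub_le_neg_one hcw (h i hi)
    · exact bordaRowScore_sub_le _ _ _
  rw [Fin.sum_ite_val_lt (Nat.sub_le _ _), Finset.sum_sub_distrib,
    Nat.cast_sub (Nat.div_le_self n m)] at key
  have hmul : ((n / m : ℕ) : ℤ) * m ≤ n := by exact_mod_cast Nat.div_mul_le_self n m
  unfold bordaScore
  linarith

/-- If a partial rank matrix contains at most the entries `w` in first position of the first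
`n - n / m` rows, and misses one of them, then `w` is not a necessary Borda winner. -/
theorem exists_completion_not_isBordaWinner {n m : ℕ} {C : Type*} [DecidableEq C] (hm : 2 ≤ m)
    (e : Fin m ≃ C) (w : C) {Y : Fin n → Fin m → Option C}
    (hY : ∀ i k c, Y i k = some c → (i : ℕ) < n - n / m ∧ (k : ℕ) = 0 ∧ c = w)
    {i₀ : Fin n} {k₀ : Fin m} (hi₀ : (i₀ : ℕ) < n - n / m) (hk₀ : (k₀ : ℕ) = 0)
    (h₀ : Y i₀ k₀ ≠ some w) :
    ∃ Q : Fin n → Fin m ≃ C, IsMatCompletion Y Q ∧ ¬ IsBordaWinner Q w := by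
  let second : Fin m := ⟨1, hm⟩
  let last : Fin m := ⟨m - 1, by omega⟩
  have hsecond : k₀ ≠ second := by simp [Fin.ext_iff, second, hk₀]
  have hlast : k₀ ≠ last := by simp only [ne_eq, Fin.ext_iff, last, hk₀]; omega
  obtain ⟨c, hcw⟩ : ∃ c, c ≠ w := by
    by_contra! h
    exact hsecond (e.injective ((h _).trans (h _).symm))
  obtain ⟨p, hpw, hpc⟩ := exists_equiv_apply_pair e hsecond hcw.symm
  obtain ⟨q, hqc, hqw⟩ := exists_equiv_apply_pair e hlast hcw
  refine ⟨fun i => if Y i k₀ = some w then p else q, ?_, fun hwin => ?_⟩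
  · intro i k d hd
    obtain ⟨-, hk, rfl⟩ := hY i k d hd
    obtain rfl : k = k₀ := Fin.ext (hk.trans hk₀.symm)
    simp only [hd, if_true, hpw]
  have hp : bordaRowScore p c - bordaRowScore p w = -1 := by
    simp [bordaRowScore, ← hpw, ← hpc, hk₀, second]
  have hq : bordaRowScore q c - bordaRowScore q w = m - 1 := by
    rw [← hqw, ← hqc]
    simp only [bordaRowScore, Equiv.symm_apply_apply, hk₀, last]
    omega
  have key : ∑ i : Fin n, ((if (i : ℕ) < n - n / m then (-1 : ℤ) else m - 1) +
      (if i = i₀ then (m : ℤ) else 0)) ≤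
      ∑ i, (bordaRowScore (if Y i k₀ = some w then p else q) c -
        bordaRowScore (if Y i k₀ = some w then p else q) w) := by
    refine Finset.sum_le_sum fun i _ => ?_
    by_cases hi : Y i k₀ = some w
    · have hne : i ≠ i₀ := by rintro rfl; exact h₀ hi
      simp [hi, hne, hp, (hY _ _ _ hi).1]
    · rw [if_neg hi, hq]
      obtain rfl | hne := eq_or_ne i i₀
      · simp [hi₀, add_comm, sub_eq_add_neg]
      · rw [if_neg hne]
        split_ifs <;> omega
  rw [Finset.sum_add_distrib, Fin.sum_ite_val_lt (Nat.sub_le _ _), Finset.sum_sub_distrib,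
    Nat.cast_sub (Nat.div_le_self n m), Finset.sum_ite_eq' Finset.univ i₀,
    if_pos (Finset.mem_univ _)] at key
  have hmul : (n : ℤ) < ((n / m : ℕ) + 1) * m := by
    exact_mod_cast Nat.lt_mul_of_div_lt (Nat.lt_succ_self _) (by omega)
  have := hwin c
  unfold bordaScore at this
  linarith

/- STATEMENT 6 -/
theorem stmt6 {n m : ℕ} {C : Type*} [Fintype C] [DecidableEq C]
    (hn : 1 ≤ n) (hm : 2 ≤ m) (hC : Fintype.card C = m) (w : C) :
    letI X : Fin n → Fin m → Option C :=
      fun i k => if (i : ℕ) < n - n / m ∧ (k : ℕ) = 0 then some w else none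
    (∀ Q : Fin n → Fin m ≃ C, IsMatCompletion X Q → IsBordaWinner Q w) ∧
    matSize X = n - n / m ∧
    (∀ R : Fin n → Fin m ≃ C, IsMatCompletion X R →
      (IsPartialMat X ∧ IsMatCompletion X R ∧
        (∀ Q : Fin n → Fin m ≃ C, IsMatCompletion X Q → IsBordaWinner Q w) ∧
        (∀ X' : Fin n → Fin m → Option C, IsPartialMat X' → PExt X' X →
          (∀ Q : Fin n → Fin m ≃ C, IsMatCompletion X' Q → IsBordaWinner Q w) →
          PExt X X'))) := by
  set X : Fin n → Fin m → Option C :=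
    fun i k => if (i : ℕ) < n - n / m ∧ (k : ℕ) = 0 then some w else none
  have hX : ∀ {i k c}, X i k = some c ↔ ((i : ℕ) < n - n / m ∧ (k : ℕ) = 0) ∧ w = c := by
    intro i k c
    simp only [X, Option.ite_none_right_eq_some, Option.some.injEq]
  have hwin : ∀ Q : Fin n → Fin m ≃ C, IsMatCompletion X Q → IsBordaWinner Q w := by
    intro Q hQ
    refine isBordaWinner_of_first fun i hi => ?_
    have h := hQ i (hX.2 ⟨⟨hi, rfl⟩, rfl⟩ : X i ⟨0, by omega⟩ = some w)
    rw [← h, Equiv.symm_apply_apply]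
  refine ⟨hwin, ?_, fun R hR => ⟨?_, hR, hwin, ?_⟩⟩
  · have hrow : ∀ i, (rowSize (X i) : ℤ) = if (i : ℕ) < n - n / m then 1 else 0 := by
      intro i
      split_ifs with hi
      · have : (Finset.univ.filter fun k : Fin m => (X i k).isSome) = {⟨0, by omega⟩} := by
          ext k
          simp [X, hi, Fin.ext_iff]
        simp [rowSize, this]
      · simp [rowSize, X, hi]
    have := Fin.sum_ite_val_lt (Nat.sub_le n (n / m)) 1 0
    zify
    simp only [matSize, Nat.cast_sum, hrow, this]
    simp
  · intro i k k' c hk hk'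
    exact Fin.ext ((hX.1 hk).1.2.trans (hX.1 hk').1.2.symm)
  · intro X' _ hsub hX'win i k c hc
    obtain ⟨⟨hi, hk⟩, rfl⟩ := hX.1 hc
    by_contra hne
    obtain ⟨Q, hQ, hQw⟩ := exists_completion_not_isBordaWinner hm
      (Fintype.equivFinOfCardEq hC).symm w
      (fun i k c h => by
        obtain ⟨⟨h1, h2⟩, h3⟩ := hX.1 (hsub i k c h)
        exact ⟨h1, h2, h3.symm⟩) hi hk hne
    exact hQw (hX'win Q hQ)
end

section
/- Let R_i be a partial row over m candidates, w a candidate, and suppose w is locked in R_i at some position k_w (i.e., R_{i,k_w} = w) and position 1 is locked (R_{i,1} ≠ null). Let R'_i be the partial row obtained by swapping positions 1 and k_w, i.e., R'_{i,1} = w, R'_{i,k_w} = R_{i,1}, and R'_{i,k} = R_{i,k} for all k ∉ {1, k_w}. Then Δ(R'_i) ≥ Δ(R_i) and |R'_i| = |R_i|. -/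
/-- Completions of a row with permuted positions are the permuted completions. -/
theorem isCompletion_comp_iff {m : ℕ} {C : Type*} (r : Fin m → Option C)
    (e : Equiv.Perm (Fin m)) (q : Fin m ≃ C) :
    IsCompletion (r ∘ e) q ↔ IsCompletion r (e.symm.trans q) := by
  constructor
  · intro h k c hk
    exact h (k := e.symm k) (by simpa using hk)
  · intro h k c hk
    simpa using h (k := e k) hk

theorem exists_isCompletion_comp_iff {m : ℕ} {C : Type*} (r : Fin m → Option C)
    (e : Equiv.Perm (Fin m)) :
    (∃ q, IsCompletion (r ∘ e) q) ↔ ∃ q, IsCompletion r q :=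
  ⟨fun ⟨q, hq⟩ => ⟨_, (isCompletion_comp_iff r e q).1 hq⟩, fun ⟨q, hq⟩ =>
    ⟨e.trans q, (isCompletion_comp_iff r e _).2 (by simpa [← Equiv.trans_assoc] using hq)⟩⟩

theorem rowSize_comp {m : ℕ} {C : Type*} (r : Fin m → Option C) (e : Equiv.Perm (Fin m)) :
    rowSize (r ∘ e) = rowSize r :=
  Finset.card_equiv e (by simp)

theorem bordaRowScore_nonneg {m : ℕ} {C : Type*} (q : Fin m ≃ C) (c : C) :
    0 ≤ bordaRowScore q c := by
  have := (q.symm c).isLt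
  unfold bordaRowScore
  omega

theorem bordaRowScore_le {m : ℕ} {C : Type*} (q : Fin m ≃ C) (c : C) :
    bordaRowScore q c ≤ m - 1 := by
  unfold bordaRowScore
  omega

/-- If permuting positions by `e` never lowers the score of `c` in a completion of `r ∘ e`, then
the maximal score of `c` in `r` is at least that in `r ∘ e`. -/
theorem rowSMax_comp_le {m : ℕ} {C : Type*} (r : Fin m → Option C) (e : Equiv.Perm (Fin m)) (c : C)
    (h : ∀ q, IsCompletion (r ∘ e) q → bordaRowScore q c ≤ bordaRowScore (e.symm.trans q) c) :
    rowSMax (r ∘ e) c ≤ rowSMax r c := by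
  by_cases hne : ∃ q, IsCompletion (r ∘ e) q
  · obtain ⟨q₀, hq₀⟩ := hne
    refine csSup_le ⟨_, q₀, hq₀, rfl⟩ ?_
    rintro _ ⟨q, hq, rfl⟩
    have hbdd : BddAbove {x : ℤ | ∃ p : Fin m ≃ C, IsCompletion r p ∧ bordaRowScore p c = x} := by
      refine ⟨(m : ℤ) - 1, ?_⟩
      rintro _ ⟨p, -, rfl⟩
      exact bordaRowScore_le p c
    exact (h q hq).trans (le_csSup hbdd ⟨_, (isCompletion_comp_iff r e q).1 hq, rfl⟩)
  · have hr : ∀ q, ¬ IsCompletion r q := fun q hq =>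
      hne ((exists_isCompletion_comp_iff r e).2 ⟨q, hq⟩)
    push Not at hne
    simp [rowSMax, hne, hr]

/-- If permuting positions by `e` never raises the score of `c` in a completion of `r ∘ e`, then
the minimal score of `c` in `r` is at most that in `r ∘ e`. -/
theorem le_rowSMin_comp {m : ℕ} {C : Type*} (r : Fin m → Option C) (e : Equiv.Perm (Fin m)) (c : C)
    (h : ∀ q, IsCompletion (r ∘ e) q → bordaRowScore (e.symm.trans q) c ≤ bordaRowScore q c) :
    rowSMin r c ≤ rowSMin (r ∘ e) c := by
  by_cases hne : ∃ q, IsCompletion (r ∘ e) q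
  · obtain ⟨q₀, hq₀⟩ := hne
    refine le_csInf ⟨_, q₀, hq₀, rfl⟩ ?_
    rintro _ ⟨q, hq, rfl⟩
    have hbdd : BddBelow {x : ℤ | ∃ p : Fin m ≃ C, IsCompletion r p ∧ bordaRowScore p c = x} := by
      refine ⟨0, ?_⟩
      rintro _ ⟨p, -, rfl⟩
      exact bordaRowScore_nonneg p c
    exact (csInf_le hbdd ⟨_, (isCompletion_comp_iff r e q).1 hq, rfl⟩).trans (h q hq)
  · have hr : ∀ q, ¬ IsCompletion r q := fun q hq =>
      hne ((exists_isCompletion_comp_iff r e).2 ⟨q, hq⟩)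
    push Not at hne
    simp [rowSMin, hne, hr]

/- STATEMENT 8 -/
theorem stmt8 {m : ℕ} {C : Type*} [Fintype C] [DecidableEq C]
    (hm : 2 ≤ m) (hC : Fintype.card C = m)
    (r : Fin m → Option C) (hr : IsPartialRow r) (w : C)
    (kw : Fin m) (hkw : r kw = some w)
    (h1 : r ⟨0, by omega⟩ ≠ none) :
    rowDelta (fun k : Fin m => if k = ⟨0, by omega⟩ then some w
        else if k = kw then r ⟨0, by omega⟩ else r k) w ≥ rowDelta r w ∧
    rowSize (fun k : Fin m => if k = ⟨0, by omega⟩ then some w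
        else if k = kw then r ⟨0, by omega⟩ else r k) = rowSize r := by
  have hrow : (fun k : Fin m => if k = ⟨0, by omega⟩ then some w
      else if k = kw then r ⟨0, by omega⟩ else r k) = r ∘ Equiv.swap ⟨0, by omega⟩ kw := by
    funext k
    simp only [Function.comp_apply, Equiv.swap_apply_def]
    split_ifs <;> simp [hkw]
  rw [hrow]
  refine ⟨Finset.sum_le_sum fun c hc => sub_le_sub ?_ ?_, rowSize_comp r _⟩
  · refine le_rowSMin_comp r _ w fun q hq => ?_
    have hw : q ⟨0, by omega⟩ = w := hq (by simp [hkw])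
    have hpos : q.symm w = ⟨0, by omega⟩ := by rw [← hw, Equiv.symm_apply_apply]
    simp only [bordaRowScore, Equiv.symm_trans_apply, Equiv.symm_symm, hpos,
      Equiv.swap_apply_left]
    omega
  · refine rowSMax_comp_le r _ c fun q hq => ?_
    have hw : q ⟨0, by omega⟩ = w := hq (by simp [hkw])
    have hpos : q.symm c ≠ ⟨0, by omega⟩ := fun h =>
      (Finset.mem_filter.1 hc).2 (by rw [← hw, ← h, Equiv.apply_symm_apply])
    simp only [bordaRowScore, Equiv.symm_trans_apply, Equiv.symm_symm, Equiv.swap_apply_def,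
      if_neg hpos]
    split_ifs
    · dsimp only
      omega
    · exact le_rfl
end

section
/- Let R_i be any partial row over m candidates and w a candidate. Then there exist natural numbers k_1, k_2 with k_1 + k_2 = |R_i| and a partial row R'_i in normal form of parameters k_1 and k_2 such that Δ(R'_i) ≥ Δ(R_i). -/
theorem IsPartialRow.exists_completion {m : ℕ} {C : Type*} [Fintype C] [DecidableEq C]
    (hC : Fintype.card C = m) {r : Fin m → Option C} (hr : IsPartialRow r) :
    ∃ q : Fin m ≃ C, IsCompletion r q := by
  have e : Fin m ≃ C := (Fintype.equivFinOfCardEq hC).symm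
  obtain ⟨g, hg⟩ := Finset.exists_equiv_extend_of_card_eq (α := Fin m) (β := C)
    (t := Finset.univ) (by simp [hC]) (s := Finset.univ.filter fun k => (r k).isSome)
    (f := fun k => (r k).getD (e k)) (by simp) (by
      intro k hk k' hk' h
      simp only [Finset.coe_filter, Finset.mem_univ, true_and, Set.mem_ofPred_eq,
        Option.isSome_iff_exists] at hk hk'
      obtain ⟨c, hc⟩ := hk
      obtain ⟨c', hc'⟩ := hk'
      simp only [hc, hc', Option.getD_some] at h
      exact hr hc (h ▸ hc'))
  refine ⟨g.trans (Equiv.subtypeUnivEquiv Finset.mem_univ), fun k c hk => ?_⟩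
  simpa [hk] using hg k (by simp [hk])

/-- An unlocked candidate can be placed at any null position. -/
theorem IsPartialRow.exists_completion_apply_eq {m : ℕ} {C : Type*} [Fintype C] [DecidableEq C]
    (hC : Fintype.card C = m) {r : Fin m → Option C} (hr : IsPartialRow r) {c : C}
    (hc : ∀ k, r k ≠ some c) {a : Fin m} (ha : r a = none) :
    ∃ q : Fin m ≃ C, IsCompletion r q ∧ q a = c := by
  have hr' : IsPartialRow (Function.update r a (some c)) := by
    intro k k' d hk hk'
    simp only [Function.update_apply] at hk hk'
    split_ifs at hk hk' with h h' h'
    · exact h.trans h'.symm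
    · exact absurd (hk ▸ hk') (hc k')
    · exact absurd (hk' ▸ hk) (hc k)
    · exact hr hk hk'
  obtain ⟨q, hq⟩ := hr'.exists_completion hC
  refine ⟨q, fun k d hk => hq ?_, hq (by simp)⟩
  rw [Function.update_of_ne, hk]
  rintro rfl
  simp [ha] at hk

/-- A completion puts unlocked candidates at null positions. -/
theorem IsCompletion.symm_apply_eq_none {m : ℕ} {C : Type*} {r : Fin m → Option C}
    {q : Fin m ≃ C} (hq : IsCompletion r q) {c : C} (hc : ∀ k, r k ≠ some c) :
    r (q.symm c) = none := by
  rw [Option.eq_none_iff_forall_ne_some]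
  intro d hd
  have : c = d := by simpa using hq hd
  exact hc _ (hd.trans (congrArg some this.symm))

/-- A candidate that a completion puts at a null position is unlocked. -/
theorem IsCompletion.ne_some_of_eq_none {m : ℕ} {C : Type*} {r : Fin m → Option C}
    {q : Fin m ≃ C} (hq : IsCompletion r q) {k : Fin m} (hk : r k = none) (k' : Fin m) :
    r k' ≠ some (q k) := by
  intro h
  rw [← q.injective (hq h), h] at hk
  simp at hk

theorem IsCompletion.bordaRowScore_eq {m : ℕ} {C : Type*} {r : Fin m → Option C}
    {q : Fin m ≃ C} (hq : IsCompletion r q) {k : Fin m} {c : C} (hk : r k = some c) :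
    bordaRowScore q c = (m : ℤ) - 1 - k := by
  simp [bordaRowScore, ← hq hk]

section Scores

variable {m : ℕ} {C : Type*} [Fintype C] [DecidableEq C] {r : Fin m → Option C} {c w : C}

theorem rowSMax_of_locked (hC : Fintype.card C = m) (hr : IsPartialRow r) {k : Fin m}
    (hk : r k = some c) : rowSMax r c = (m : ℤ) - 1 - k := by
  obtain ⟨q, hq⟩ := hr.exists_completion hC
  refine IsGreatest.csSup_eq ⟨⟨q, hq, hq.bordaRowScore_eq hk⟩, ?_⟩
  rintro _ ⟨q', hq', rfl⟩
  exact (hq'.bordaRowScore_eq hk).le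

theorem rowSMin_of_locked (hC : Fintype.card C = m) (hr : IsPartialRow r) {k : Fin m}
    (hk : r k = some c) : rowSMin r c = (m : ℤ) - 1 - k := by
  obtain ⟨q, hq⟩ := hr.exists_completion hC
  refine IsLeast.csInf_eq ⟨⟨q, hq, hq.bordaRowScore_eq hk⟩, ?_⟩
  rintro _ ⟨q', hq', rfl⟩
  exact (hq'.bordaRowScore_eq hk).ge

theorem rowSMax_of_unlocked (hC : Fintype.card C = m) (hr : IsPartialRow r)
    (hc : ∀ k, r k ≠ some c) {a : Fin m} (ha : IsLeast {k | r k = none} a) :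
    rowSMax r c = (m : ℤ) - 1 - a := by
  obtain ⟨q, hq, hqa⟩ := hr.exists_completion_apply_eq hC hc ha.1
  refine IsGreatest.csSup_eq ⟨⟨q, hq, by simp [bordaRowScore, ← hqa]⟩, ?_⟩
  rintro _ ⟨q', hq', rfl⟩
  have : a ≤ q'.symm c := ha.2 (hq'.symm_apply_eq_none hc)
  rw [Fin.le_def] at this
  simp only [bordaRowScore]
  lia

theorem rowSMin_of_unlocked (hC : Fintype.card C = m) (hr : IsPartialRow r)
    (hc : ∀ k, r k ≠ some c) {b : Fin m} (hb : IsGreatest {k | r k = none} b) :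
    rowSMin r c = (m : ℤ) - 1 - b := by
  obtain ⟨q, hq, hqb⟩ := hr.exists_completion_apply_eq hC hc hb.1
  refine IsLeast.csInf_eq ⟨⟨q, hq, by simp [bordaRowScore, ← hqb]⟩, ?_⟩
  rintro _ ⟨q', hq', rfl⟩
  have : q'.symm c ≤ b := hb.2 (hq'.symm_apply_eq_none hc)
  rw [Fin.le_def] at this
  simp only [bordaRowScore]
  lia

theorem sum_rowSMax (hC : Fintype.card C = m) (hr : IsPartialRow r) {a : Fin m}
    (ha : IsLeast {k | r k = none} a) :
    ∑ c, rowSMax r c = ∑ k : Fin m, ((m : ℤ) - 1 - k) +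
      ∑ k with r k = none, ((k : ℤ) - a) := by
  obtain ⟨q, hq⟩ := hr.exists_completion hC
  rw [← q.sum_comp, Finset.sum_filter, ← Finset.sum_add_distrib]
  refine Finset.sum_congr rfl fun k _ => ?_
  split_ifs with hk
  · rw [rowSMax_of_unlocked hC hr (hq.ne_some_of_eq_none hk) ha]
    ring
  · obtain ⟨c, hc⟩ := Option.ne_none_iff_exists'.1 hk
    rw [hq hc, rowSMax_of_locked hC hr hc, add_zero]

theorem rowDelta_eq (hC : Fintype.card C = m) (r : Fin m → Option C) (w : C) :
    rowDelta r w = ((m : ℤ) - 1) * rowSMin r w + rowSMax r w - ∑ c, rowSMax r c := by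
  have h := Finset.sum_erase_eq_sub (f := fun c => rowSMin r w - rowSMax r c) (Finset.mem_univ w)
  rw [rowDelta, Finset.filter_ne', h, Finset.sum_sub_distrib]
  simp [hC]
  ring

end Scores

theorem sum_range_le_sum_sub {m : ℕ} (s : Finset (Fin m)) (a : Fin m) (ha : ∀ k ∈ s, a ≤ k) :
    ∑ i ∈ Finset.range s.card, (i : ℤ) ≤ ∑ k ∈ s, ((k : ℤ) - a) := by
  have hinj : Set.InjOn (fun k : Fin m => (k : ℤ) - a) s := fun i _ j _ h =>
    Fin.ext (by simpa using h)
  have h := Finset.sum_range_le_sum (s := s.image fun k : Fin m => (k : ℤ) - a) (c := 0) (by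
    intro x hx
    obtain ⟨k, hk, rfl⟩ := Finset.mem_image.1 hx
    exact sub_nonneg.2 (Int.ofNat_le.2 (ha k hk)))
  simpa [Finset.card_image_of_injOn hinj, Finset.sum_image hinj] using h

/-- The row obtained from `e` by erasing `t` consecutive positions starting at index `k`. -/
def eraseBlock {m : ℕ} {C : Type*} (e : Fin m ≃ C) (k t : ℕ) (i : Fin m) : Option C :=
  if k ≤ i ∧ (i : ℕ) < k + t then none else some (e i)

section EraseBlock

variable {m : ℕ} {C : Type*} {e : Fin m ≃ C} {k t : ℕ}

theorem eraseBlock_eq_none {i : Fin m} :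
    eraseBlock e k t i = none ↔ k ≤ i ∧ (i : ℕ) < k + t := by
  simp [eraseBlock]

theorem isPartialRow_eraseBlock : IsPartialRow (eraseBlock e k t) := by
  intro i j c hi hj
  simp only [eraseBlock, Option.ite_none_left_eq_some, Option.some.injEq] at hi hj
  exact e.injective (hi.2.trans hj.2.symm)

theorem isNormalForm_eraseBlock (h : k + t ≤ m) :
    IsNormalForm (eraseBlock e k t) k (m - t - k) := by
  intro i
  rw [eraseBlock_eq_none]
  lia

theorem isLeast_eraseBlock (ht : 0 < t) (h : k + t ≤ m) :
    IsLeast {i | eraseBlock e k t i = none} ⟨k, by lia⟩ :=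
  ⟨eraseBlock_eq_none.2 (by simp [ht]), fun _ hi => (eraseBlock_eq_none.1 hi).1⟩

theorem isGreatest_eraseBlock (ht : 0 < t) (h : k + t ≤ m) :
    IsGreatest {i | eraseBlock e k t i = none} ⟨k + t - 1, by lia⟩ := by
  refine ⟨eraseBlock_eq_none.2 (by dsimp only; lia), fun i hi => ?_⟩
  have := eraseBlock_eq_none.1 hi
  rw [Fin.le_def]
  dsimp only
  lia

theorem sum_eraseBlock (h : k + t ≤ m) :
    ∑ i with eraseBlock e k t i = none, ((i : ℤ) - k) = ∑ i ∈ Finset.range t, (i : ℤ) := by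
  symm
  refine Finset.sum_bij (fun i hi => ⟨k + i, by have := Finset.mem_range.1 hi; lia⟩) ?_ ?_ ?_ ?_
  · simp [eraseBlock_eq_none]
  · simp
  · intro j hj
    simp only [Finset.mem_filter, eraseBlock_eq_none] at hj
    exact ⟨j - k, Finset.mem_range.2 (by lia), Fin.ext (by dsimp only; lia)⟩
  · simp

end EraseBlock

theorem card_null_add_rowSize {m : ℕ} {C : Type*} [DecidableEq C] (r : Fin m → Option C) :
    (Finset.univ.filter fun k => r k = none).card + rowSize r = m := by
  simpa [rowSize, Option.isSome_iff_ne_none] using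
    Finset.card_filter_add_card_filter_not (s := Finset.univ) (fun k : Fin m => r k = none)

/-- Moving the null positions to a block does not decrease the total margin, provided the extreme
scores of `w` do not decrease. -/
theorem rowDelta_le_eraseBlock {m : ℕ} {C : Type*} [Fintype C] [DecidableEq C]
    (hC : Fintype.card C = m) {r : Fin m → Option C} (hr : IsPartialRow r) (w : C) {a : Fin m}
    (ha : IsLeast {k | r k = none} a) {e : Fin m ≃ C} {k : ℕ}
    (hk : k + (Finset.univ.filter fun k => r k = none).card ≤ m)
    (hmin : rowSMin r w ≤
      rowSMin (eraseBlock e k (Finset.univ.filter fun k => r k = none).card) w)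
    (hmax : rowSMax r w ≤
      rowSMax (eraseBlock e k (Finset.univ.filter fun k => r k = none).card) w) :
    rowDelta r w ≤
      rowDelta (eraseBlock e k (Finset.univ.filter fun k => r k = none).card) w := by
  have ht : 0 < (Finset.univ.filter fun k => r k = none).card :=
    Finset.card_pos.2 ⟨a, by simpa using ha.1⟩
  have hm : (0 : ℤ) ≤ (m : ℤ) - 1 := by have := a.pos; lia
  have hsum := sum_range_le_sum_sub (Finset.univ.filter fun k => r k = none) a
    fun k hk => ha.2 (by simpa using hk)
  have hmul := mul_le_mul_of_nonneg_left hmin hm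
  rw [rowDelta_eq hC, rowDelta_eq hC, sum_rowSMax hC hr ha,
    sum_rowSMax hC isPartialRow_eraseBlock (isLeast_eraseBlock ht hk), sum_eraseBlock hk]
  linarith

/- STATEMENT 11 -/
theorem stmt11 {m : ℕ} {C : Type*} [Fintype C] [DecidableEq C]
    (hm : 2 ≤ m) (hC : Fintype.card C = m)
    (r : Fin m → Option C) (hr : IsPartialRow r) (w : C) :
    ∃ (k1 k2 : ℕ) (r' : Fin m → Option C), k1 + k2 = rowSize r ∧
      IsPartialRow r' ∧ IsNormalForm r' k1 k2 ∧ rowDelta r w ≤ rowDelta r' w := by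
  set t := (Finset.univ.filter fun k => r k = none).card with ht
  have hsize : t + rowSize r = m := card_null_add_rowSize r
  rcases (Finset.univ.filter fun k => r k = none).eq_empty_or_nonempty with hN | hN
  · refine ⟨m, 0, r, ?_, hr, fun k => ?_, le_rfl⟩
    · simpa [ht, hN] using hsize.symm
    · have := Finset.filter_eq_empty_iff.1 hN (Finset.mem_univ k)
      simp only [this, false_iff]
      lia
  have ht0 : 0 < t := hN.card_pos
  obtain ⟨a, ha⟩ : ∃ a, IsLeast {k | r k = none} a :=
    ⟨_, by simpa using Finset.isLeast_min' _ hN⟩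
  obtain ⟨b, hb⟩ : ∃ b, IsGreatest {k | r k = none} b :=
    ⟨_, by simpa using Finset.isGreatest_max' _ hN⟩
  have hab : a + t ≤ b + 1 := by
    have : t ≤ (Finset.Icc a b).card := Finset.card_le_card fun k hk =>
      Finset.mem_Icc.2 ⟨ha.2 (by simpa using hk), hb.2 (by simpa using hk)⟩
    have hle : a ≤ b := ha.2 hb.1
    rw [Fin.card_Icc] at this
    lia
  by_cases hw : ∃ p, r p = some w
  · obtain ⟨p, hp⟩ := hw
    have hpos : 0 < rowSize r := Finset.card_pos.2 ⟨p, by simp [hp]⟩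
    have hk : max (a : ℕ) 1 + t ≤ m := by lia
    obtain ⟨e, he⟩ : ∃ e : Fin m ≃ C, e ⟨0, by lia⟩ = w := by
      let e₀ := (Fintype.equivFinOfCardEq hC).symm
      exact ⟨(Equiv.swap ⟨0, by lia⟩ (e₀.symm w)).trans e₀, by simp⟩
    have hw' : eraseBlock e (max (a : ℕ) 1) t ⟨0, by lia⟩ = some w := by
      simp [eraseBlock, he]
    refine ⟨max (a : ℕ) 1, m - t - max (a : ℕ) 1, eraseBlock e (max (a : ℕ) 1) t, by lia, isPartialRow_eraseBlock,
      isNormalForm_eraseBlock hk, rowDelta_le_eraseBlock hC hr w ha hk ?_ ?_⟩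
    · rw [rowSMin_of_locked hC hr hp, rowSMin_of_locked hC isPartialRow_eraseBlock hw']
      dsimp only
      lia
    · rw [rowSMax_of_locked hC hr hp, rowSMax_of_locked hC isPartialRow_eraseBlock hw']
      dsimp only
      lia
  · push Not at hw
    have hk : a + t ≤ m := by lia
    obtain ⟨e, -, he⟩ := hr.exists_completion_apply_eq hC hw ha.1
    have hw' : ∀ i, eraseBlock e a t i ≠ some w := by
      intro i hi
      simp only [eraseBlock, Option.ite_none_left_eq_some, Option.some.injEq] at hi
      obtain rfl := e.injective (hi.2.trans he.symm)
      lia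
    refine ⟨a, m - t - a, eraseBlock e a t, by lia, isPartialRow_eraseBlock,
      isNormalForm_eraseBlock hk, rowDelta_le_eraseBlock hC hr w ha hk ?_ ?_⟩
    · rw [rowSMin_of_unlocked hC hr hw hb, rowSMin_of_unlocked hC isPartialRow_eraseBlock hw'
        (isGreatest_eraseBlock ht0 hk)]
      dsimp only
      lia
    · rw [rowSMax_of_unlocked hC hr hw ha, rowSMax_of_unlocked hC isPartialRow_eraseBlock hw'
        (isLeast_eraseBlock ht0 hk)]
end
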